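/- arXiv:1908.06157 — 4 statements merged into one kernel-verified Lean document; each statement's English description precedes it below -/
import Mathlib

section
/- Fix m ∈ ℤ⁺ and let β_1(m), …, β_ℓ(m) be given by the Minkowski algorithm for α. Define the norm G_m on ℝ^ℓ by G_m(x_1, …, x_ℓ) = max(|x_1|, …, |x_ℓ|, (m/|β_ℓ(m)|)·|α_1 x_1 + ⋯ + α_n x_n + x_ℓ|). If μ_1 ≤ μ_2 ≤ ⋯ ≤ μ_ℓ are the successive minima of the lattice ℤ^ℓ with respect to G_m, then μ_ℓ ≥ m. -/
/-- ξ(r) = p + α₁q₁ + ⋯ + αₙqₙ for r = (q₁, …, qₙ, p) ∈ ℤ^(n+1). -/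
noncomputable def xi {n : ℕ} (α : Fin n → ℝ) (r : Fin (n + 1) → ℤ) : ℝ :=
  (r (Fin.last n) : ℝ) + ∑ i : Fin n, α i * (r (Fin.castSucc i) : ℝ)

/-- The real span of the rows of `A` preceding row `j`. -/
def earlierRowSpan {n : ℕ} (A : Matrix (Fin (n + 1)) (Fin (n + 1)) ℤ) (j : Fin (n + 1)) :
    Submodule ℝ (Fin (n + 1) → ℝ) :=
  Submodule.span ℝ {x : Fin (n + 1) → ℝ | ∃ i : Fin (n + 1), i < j ∧ x = fun k => (A i k : ℝ)}

/-- `A` is the matrix produced by the Minkowski algorithm at stage `m`: each row has sup norm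
at most `m`, is linearly independent of the previous rows, minimizes `|ξ|` among all integer
vectors with sup norm at most `m` that are linearly independent of the previous rows, and its
first nonzero entry is positive. -/
def IsMinkowskiMatrix {n : ℕ} (α : Fin n → ℝ) (m : ℕ)
    (A : Matrix (Fin (n + 1)) (Fin (n + 1)) ℤ) : Prop :=
  ∀ j : Fin (n + 1),
    (∀ k, |A j k| ≤ (m : ℤ)) ∧
    (fun k => (A j k : ℝ)) ∉ earlierRowSpan A j ∧
    (∀ w : Fin (n + 1) → ℤ, (∀ k, |w k| ≤ (m : ℤ)) →
      ((fun k => (w k : ℝ)) ∉ earlierRowSpan A j) → |xi α (A j)| ≤ |xi α w|) ∧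
    (∃ k₀ : Fin (n + 1), 0 < A j k₀ ∧ ∀ k < k₀, A j k = 0)

/-- `B` (indexed from 0, so `B 0 = B₁`) is the Minkowski chain of `α`: the subsequence of
distinct matrices among the matrices `A m` produced by the Minkowski algorithm, starting
with `A 1`. -/
def IsMinkowskiChain {n : ℕ} (α : Fin n → ℝ)
    (B : ℕ → Matrix (Fin (n + 1)) (Fin (n + 1)) ℤ) : Prop :=
  ∃ (A : ℕ → Matrix (Fin (n + 1)) (Fin (n + 1)) ℤ) (idx : ℕ → ℕ),
    (∀ m, 1 ≤ m → IsMinkowskiMatrix α m (A m)) ∧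
    StrictMono idx ∧ idx 0 = 1 ∧
    (∀ k, B k = A (idx k)) ∧
    (∀ k m, idx k ≤ m → m < idx (k + 1) → A m = A (idx k)) ∧
    (∀ k, A (idx (k + 1)) ≠ A (idx k))

/-- The `j`-th successive minimum (`j` = number of vectors) of a set `Λ ⊆ ℝ^ℓ` with
respect to a norm `F`: the infimum of all `μ > 0` such that there exist `j` linearly
independent vectors `v ∈ Λ` with `F(v) ≤ μ`. -/
noncomputable def succMin (l : ℕ) (F : (Fin l → ℝ) → ℝ) (Λ : Set (Fin l → ℝ)) (j : ℕ) : ℝ :=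
  sInf {μ : ℝ | 0 < μ ∧ ∃ v : Fin j → Fin l → ℝ,
    (∀ i, v i ∈ Λ) ∧ LinearIndependent ℝ v ∧ ∀ i, F (v i) ≤ μ}

/-- If `α₁, …, αₙ, 1` are linearly independent over `ℚ`, then `ξ` vanishes only at `0`. -/
theorem eq_zero_of_xi_eq_zero {n : ℕ} {α : Fin n → ℝ}
    (hind : LinearIndependent ℚ (Fin.snoc α 1 : Fin (n + 1) → ℝ))
    {r : Fin (n + 1) → ℤ} (hr : xi α r = 0) : r = 0 := by
  rw [Fintype.linearIndependent_iff] at hind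
  have hcoeff := hind (fun k => (r k : ℚ)) (by
    rw [Fin.sum_univ_castSucc]
    simp only [Fin.snoc_castSucc, Fin.snoc_last, Rat.smul_def, Rat.cast_intCast, mul_one]
    rw [← hr, xi, add_comm]
    simp only [mul_comm])
  funext k
  exact_mod_cast hcoeff k

/-- Every `n + 1` linearly independent vectors of `ℝ^(n+1)` include one outside a given proper
subspace. -/
theorem exists_notMem_of_linearIndependent {n : ℕ} {v : Fin (n + 1) → Fin (n + 1) → ℝ}
    (hv : LinearIndependent ℝ v) {S : Submodule ℝ (Fin (n + 1) → ℝ)}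
    {x : Fin (n + 1) → ℝ} (hx : x ∉ S) : ∃ i, v i ∉ S := by
  by_contra! h
  have htop : Submodule.span ℝ (Set.range v) = ⊤ :=
    hv.span_eq_top_of_card_eq_finrank (by simp)
  have hle : Submodule.span ℝ (Set.range v) ≤ S :=
    Submodule.span_le.2 (Set.range_subset_iff.2 h)
  exact hx (hle (htop ▸ Submodule.mem_top))

/-- Fix `m ≥ 1`, let `β₁(m), …, β_ℓ(m)` come from the Minkowski algorithm for `α`, and
define the norm `G_m(x) = max(|x₁|, …, |x_ℓ|, (m/|β_ℓ(m)|)·|α₁x₁ + ⋯ + αₙxₙ + x_ℓ|)` on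
`ℝ^ℓ`. Then the last successive minimum `μ_ℓ` of the lattice `ℤ^ℓ` with respect to `G_m`
satisfies `μ_ℓ ≥ m`. -/
theorem last_successive_minimum_ge {n : ℕ} (α : Fin n → ℝ)
    (hind : LinearIndependent ℚ (Fin.snoc α 1 : Fin (n + 1) → ℝ))
    (m : ℕ) (hm : 1 ≤ m)
    (A : Matrix (Fin (n + 1)) (Fin (n + 1)) ℤ) (hA : IsMinkowskiMatrix α m A) :
    (m : ℝ) ≤ succMin (n + 1)
      (fun x => max (⨆ i, |x i|)
        (((m : ℝ) / |xi α (A (Fin.last n))|) *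
          |(∑ i : Fin n, α i * x (Fin.castSucc i)) + x (Fin.last n)|))
      {v : Fin (n + 1) → ℝ | ∀ i, ∃ z : ℤ, v i = (z : ℝ)} (n + 1) := by
  have hβ : 0 < |xi α (A (Fin.last n))| := by
    obtain ⟨-, -, -, k₀, hk₀, -⟩ := hA (Fin.last n)
    refine abs_pos.2 fun h => ?_
    simp [eq_zero_of_xi_eq_zero hind h] at hk₀
  refine le_csInf ?_ ?_
  · set G : (Fin (n + 1) → ℝ) → ℝ := fun x => max (⨆ i, |x i|)
      (((m : ℝ) / |xi α (A (Fin.last n))|) *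
        |(∑ i : Fin n, α i * x (Fin.castSucc i)) + x (Fin.last n)|)
    have hbdd : BddAbove (Set.range fun i => G (Pi.single i 1)) := (Set.finite_range _).bddAbove
    obtain ⟨C, hC⟩ := hbdd
    refine ⟨max C 1, by positivity, fun i => Pi.single i 1, fun i k => ?_,
      Pi.linearIndependent_single_one (Fin (n + 1)) ℝ,
      fun i => (hC ⟨i, rfl⟩).trans (le_max_left _ _)⟩
    exact ⟨(Pi.single i 1 : Fin (n + 1) → ℤ) k, by by_cases h : k = i <;> simp [h]⟩
  · rintro μ ⟨-, v, hv, hli, hμ⟩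
    by_contra! hlt
    obtain ⟨-, hrow, hmin, -⟩ := hA (Fin.last n)
    obtain ⟨i, hi⟩ := exists_notMem_of_linearIndependent hli hrow
    choose w hw using hv i
    have hvw : v i = fun k => (w k : ℝ) := funext hw
    have hF := hμ i
    rw [hvw] at hi hF
    obtain ⟨hsup, hξ⟩ := max_le_iff.1 hF
    have hwm : ∀ k, |w k| ≤ (m : ℤ) := fun k => by
      have hk : |(w k : ℝ)| ≤ ⨆ k, |(w k : ℝ)| :=
        le_ciSup (f := fun k => |(w k : ℝ)|) (Set.finite_range _).bddAbove k
      exact_mod_cast (hk.trans hsup).trans hlt.le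
    have hle := hmin w hwm hi
    rw [add_comm, ← xi] at hξ
    refine hlt.not_ge (le_trans ?_ hξ)
    calc (m : ℝ) = (m : ℝ) / |xi α (A (Fin.last n))| * |xi α (A (Fin.last n))| :=
          (div_mul_cancel₀ _ hβ.ne').symm
      _ ≤ _ := by gcongr
end

section
/- For any norm F on ℝ^ℓ and any full-rank lattice Λ ⊂ ℝ^ℓ there exists an ordered ℤ-basis v_1, …, v_ℓ of Λ that is reduced with respect to F. -/
/-- `F` is a norm on `ℝ^ℓ`. -/
def IsNorm {l : ℕ} (F : (Fin l → ℝ) → ℝ) : Prop :=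
  (∀ x, 0 ≤ F x) ∧ (∀ x, F x = 0 ↔ x = 0) ∧
    (∀ (a : ℝ) (x), F (a • x) = |a| * F x) ∧ ∀ x y, F (x + y) ≤ F x + F y

/-- `v₁, …, v_ℓ` is an ordered `ℤ`-basis of the full-rank lattice `Λ ⊆ ℝ^ℓ`. -/
def IsZBasisOf {l : ℕ} (v : Fin l → Fin l → ℝ) (Λ : Set (Fin l → ℝ)) : Prop :=
  LinearIndependent ℝ v ∧ Λ = {x | ∃ a : Fin l → ℤ, x = ∑ i, (a i : ℝ) • v i}

/-- For an ordered basis `v` of a lattice, `Rset v k` is the set of lattice vectors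
`a₁v₁ + ⋯ + a_ℓv_ℓ` with `gcd(a_k, a_{k+1}, …, a_ℓ) = 1`. -/
def Rset {l : ℕ} (v : Fin l → Fin l → ℝ) (k : Fin l) : Set (Fin l → ℝ) :=
  {x | ∃ a : Fin l → ℤ, x = ∑ i, (a i : ℝ) • v i ∧
    Finset.gcd (Finset.univ.filter fun i => k ≤ i) a = 1}

/-- The ordered `ℤ`-basis `v` of `Λ` is reduced with respect to the norm `F`: for each `k`
one has `F(x) ≥ F(v_k)` for all `x ∈ R_k`. -/
def IsReducedBasis {l : ℕ} (F : (Fin l → ℝ) → ℝ) (Λ : Set (Fin l → ℝ))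
    (v : Fin l → Fin l → ℝ) : Prop :=
  IsZBasisOf v Λ ∧ ∀ k : Fin l, ∀ x ∈ Rset v k, F (v k) ≤ F x

open Module Submodule

/-- A vector whose coordinates from the `k`-th one on are coprime can replace the `k`-th vector
of a `ℤ`-basis, provided the later basis vectors are suitably modified. -/
theorem Module.Basis.exists_basis_of_gcd_eq_one {l : ℕ} {M : Type*} [AddCommGroup M]
    (v : Basis (Fin l) ℤ M) (k : Fin l) (x : M)
    (hx : Finset.gcd (Finset.univ.filter fun i => k ≤ i) (v.repr x) = 1) :
    ∃ w : Basis (Fin l) ℤ M, (∀ i < k, w i = v i) ∧ w k = x := by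
  classical
  have : Module.Free ℤ M := .of_basis v
  have : Module.Finite ℤ M := .of_basis v
  let u : {i // i ≤ k} → M := fun i => Function.update v k x i
  let k' : {i // i ≤ k} := ⟨k, le_rfl⟩
  have hu_k : u k' = x := by simp [u, k']
  have hu_ne {i : {i // i ≤ k}} (hi : i ≠ k') : u i = v i := by
    have : (i : Fin l) ≠ k := fun h => hi (Subtype.ext h)
    simp [u, this]
  have hcoord (c : {i // i ≤ k} → ℤ) (j : Fin l) (hj : k ≤ j) :
      v.repr (∑ i, c i • u i) j = c k' * v.repr x j := by
    simp only [map_sum, map_smul, Finsupp.coe_finsetSum, Finset.sum_apply, Finsupp.smul_apply,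
      smul_eq_mul]
    rw [Finset.sum_eq_single k' _ (by simp), hu_k]
    intro i _ hi
    have hij : (i : Fin l) ≠ j := fun h =>
      hi (Subtype.ext (le_antisymm i.2 (h ▸ hj)))
    rw [hu_ne hi, v.repr_self, Finsupp.single_eq_of_ne hij.symm, mul_zero]
  have hli : LinearIndependent ℤ u := by
    rw [Fintype.linearIndependent_iff]
    intro c hc
    have hck : c k' = 0 := by
      by_contra hne
      have h0 : Finset.gcd (Finset.univ.filter fun i => k ≤ i) (v.repr x) = 0 := by
        rw [Finset.gcd_eq_zero_iff]
        intro j hj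
        have := hcoord c j (by simpa using hj)
        rw [hc] at this
        simpa [hne] using this.symm
      exact one_ne_zero (hx.symm.trans h0)
    intro j
    by_cases hj : j = k'
    · rw [hj, hck]
    have := congrArg (fun y => v.repr y j) hc
    simp only [map_sum, map_smul, Finsupp.coe_finsetSum, Finset.sum_apply, Finsupp.smul_apply,
      smul_eq_mul] at this
    rw [Finset.sum_eq_single j _ (by simp), hu_ne hj] at this
    · simpa using this
    · intro i _ hi
      by_cases hik : i = k'
      · rw [hik, hck, zero_mul]
      · have hij : (j : Fin l) ≠ i := fun h => hi (Subtype.ext h.symm)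
        rw [hu_ne hik, v.repr_self, Finsupp.single_eq_of_ne hij, mul_zero]
  set N : Submodule ℤ M := span ℤ (Set.range u) with hN
  have hmem (y : M) : y ∈ N ↔ ∃ c : ℤ, ∀ j, k ≤ j → v.repr y j = c * v.repr x j := by
    constructor
    · intro hy
      obtain ⟨c, rfl⟩ := (mem_span_range_iff_exists_fun ℤ).1 hy
      exact ⟨c k', hcoord c⟩
    · rintro ⟨c, hc⟩
      have hxN : x ∈ N := hu_k ▸ subset_span ⟨k', rfl⟩
      rw [← sub_add_cancel y (c • x)]
      refine N.add_mem ?_ (N.smul_mem c hxN)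
      rw [← v.sum_repr (y - c • x)]
      refine N.sum_mem fun i _ => ?_
      rcases le_or_gt k i with hi | hi
      · simp [hc i hi]
      · refine N.smul_mem _ (subset_span ⟨⟨i, hi.le⟩, hu_ne fun h => hi.ne ?_⟩)
        exact congrArg Subtype.val h
  have : IsTorsionFree ℤ (M ⧸ N) := by
    rw [isTorsionFree_iff_smul_eq_zero]
    intro n q hq
    obtain ⟨y, rfl⟩ := N.mkQ_surjective q
    by_cases hn : n = 0
    · exact Or.inl hn
    right
    rw [← map_smul, mkQ_apply, Quotient.mk_eq_zero, hmem] at hq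
    rw [mkQ_apply, Quotient.mk_eq_zero, hmem]
    obtain ⟨c, hc⟩ := hq
    have hdvd : n ∣ c := by
      have h : n ∣ Finset.gcd (Finset.univ.filter fun i => k ≤ i) fun j => c * v.repr x j :=
        Finset.dvd_gcd fun j hj => ⟨v.repr y j, by simpa using (hc j (by simpa using hj)).symm⟩
      rw [Finset.gcd_mul_left, hx, mul_one] at h
      exact (dvd_normalize_iff).1 h
    obtain ⟨d, rfl⟩ := hdvd
    refine ⟨d, fun j hj => mul_left_cancel₀ hn ?_⟩
    simpa [mul_assoc] using hc j hj
  have hcard : finrank ℤ (M ⧸ N) = Fintype.card {i // ¬ i ≤ k} := by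
    have h := N.finrank_quotient_add_finrank
    rw [finrank_eq_card_basis v, finrank_eq_card_basis (Basis.span hli)] at h
    have := Fintype.card_subtype_compl (fun i : Fin l => i ≤ k)
    omega
  let bQ : Basis {i // ¬ i ≤ k} ℤ (M ⧸ N) :=
    (finBasis ℤ (M ⧸ N)).reindex ((finCongr hcard).trans (Fintype.equivFin _).symm)
  let w := ((Basis.span hli).sumQuot bQ).reindex (Equiv.sumCompl fun i => i ≤ k)
  have hw (i : {i // i ≤ k}) : w i = u i := by
    simp [w, Basis.span_apply]
  refine ⟨w, fun i hi => ?_, (hw k').trans hu_k⟩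
  exact (hw ⟨i, hi.le⟩).trans (hu_ne fun h => hi.ne (congrArg Subtype.val h))

theorem isZBasisOf_iff {l : ℕ} {v : Fin l → Fin l → ℝ} {Λ : Set (Fin l → ℝ)} :
    IsZBasisOf v Λ ↔ LinearIndependent ℝ v ∧ Λ = span ℤ (Set.range v) := by
  have : {x | ∃ a : Fin l → ℤ, x = ∑ i, (a i : ℝ) • v i} = (span ℤ (Set.range v) : Set _) := by
    ext x
    simp [mem_span_range_iff_exists_fun, Int.cast_smul_eq_zsmul, eq_comm]
  rw [IsZBasisOf, this]

/-- A vector of `Rset v k` can serve as the `k`-th vector of a `ℤ`-basis of the same lattice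
having the same first vectors as `v`. -/
theorem IsZBasisOf.exists_of_mem_Rset {l : ℕ} {v : Fin l → Fin l → ℝ} {Λ : Set (Fin l → ℝ)}
    (hv : IsZBasisOf v Λ) {k : Fin l} {x : Fin l → ℝ} (hx : x ∈ Rset v k) :
    ∃ w, IsZBasisOf w Λ ∧ (∀ i < k, w i = v i) ∧ w k = x := by
  obtain ⟨hli, rfl⟩ := isZBasisOf_iff.1 hv
  obtain ⟨a, rfl, ha⟩ := hx
  let b := Basis.span (hli.restrict_scalars' ℤ)
  have hb (i) : (b i : Fin l → ℝ) = v i :=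
    congrArg Subtype.val (Basis.span_apply _ i)
  obtain ⟨w, hwlt, hwk⟩ := b.exists_basis_of_gcd_eq_one k (∑ i, a i • b i)
    (by rwa [b.repr_sum_self])
  have hspan : span ℤ (Set.range fun i => (w i : Fin l → ℝ)) = span ℤ (Set.range v) := by
    have h := congrArg (Submodule.map (span ℤ (Set.range v)).subtype) w.span_eq
    rw [map_span, ← Set.range_comp, map_subtype_top] at h
    exact h
  refine ⟨fun i => w i, isZBasisOf_iff.2 ⟨?_, by rw [hspan]⟩, fun i hi => ?_, ?_⟩
  · refine linearIndependent_of_top_le_span_of_card_eq_finrank ?_ (by simp)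
    rw [← hli.span_eq_top_of_card_eq_finrank' (by simp), span_le]
    intro y hy
    have : y ∈ span ℤ (Set.range fun i => (w i : Fin l → ℝ)) := by
      rw [hspan]
      exact subset_span hy
    exact span_le_restrictScalars ℤ ℝ _ this
  · simp only [hwlt i hi, hb]
  · simp [hwk, hb, Int.cast_smul_eq_zsmul]

/-- A lattice contains only finitely many vectors of bounded length. -/
theorem finite_span_int_inter_le {ι E : Type*} [Finite ι] [AddCommGroup E] [Module ℝ E]
    (b : Basis ι ℝ E) (F : E → ℝ) (hnonneg : ∀ x, 0 ≤ F x) (hzero : ∀ x, F x = 0 ↔ x = 0)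
    (hsmul : ∀ (a : ℝ) (x), F (a • x) = |a| * F x) (hadd : ∀ x y, F (x + y) ≤ F x + F y) (C : ℝ) :
    ({x | F x ≤ C} ∩ span ℤ (Set.range b)).Finite := by
  let _ : Norm E := ⟨F⟩
  have core : NormedSpace.Core ℝ E :=
    { norm_nonneg := hnonneg
      norm_smul := hsmul
      norm_triangle := hadd
      norm_eq_zero_iff := hzero }
  let _ : NormedAddCommGroup E := .ofCore core
  let _ : NormedSpace ℝ E := .ofCore core
  have : FiniteDimensional ℝ E := .of_basis b
  have : ProperSpace E := FiniteDimensional.proper ℝ E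
  exact ZSpan.setFinite_inter b (isBounded_iff_forall_norm_le.2 ⟨C, fun _ h => h⟩)

theorem wellFounded_norm_lt {l : ℕ} {F : (Fin l → ℝ) → ℝ} (hF : IsNorm F) {Λ : Set (Fin l → ℝ)}
    {b : Fin l → Fin l → ℝ} (hb : IsZBasisOf b Λ) :
    WellFounded fun x y : Λ => F x < F y := by
  obtain ⟨hli, hΛ⟩ := isZBasisOf_iff.1 hb
  let B := basisOfLinearIndependentOfCardEqFinrank' b hli (by simp)
  have hfin (C : ℝ) : {x : Λ | F x ≤ C}.Finite := by
    have h := finite_span_int_inter_le B F hF.1 hF.2.1 hF.2.2.1 hF.2.2.2 C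
    rw [coe_basisOfLinearIndependentOfCardEqFinrank', ← hΛ] at h
    refine Set.Finite.of_finite_image (h.subset ?_) Subtype.val_injective.injOn
    rintro _ ⟨x, hx, rfl⟩
    exact ⟨hx, x.2⟩
  rw [WellFounded.wellFounded_iff_has_min]
  rintro S ⟨y, hy⟩
  obtain ⟨m, ⟨hmy, hmS⟩, hm⟩ := Set.exists_min_image ({x : Λ | F x ≤ F y} ∩ S) (fun x => F x)
    ((hfin (F y)).inter_of_left S) ⟨y, le_refl (F y), hy⟩
  exact ⟨m, hmS, fun x hx hlt => hlt.not_ge (hm x ⟨hlt.le.trans hmy, hx⟩)⟩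

/-- For any norm `F` on `ℝ^ℓ` and any full-rank lattice `Λ ⊆ ℝ^ℓ` there exists an ordered
`ℤ`-basis of `Λ` that is reduced with respect to `F`. -/
theorem exists_reduced_basis {l : ℕ} (F : (Fin l → ℝ) → ℝ) (hF : IsNorm F)
    (Λ : Set (Fin l → ℝ)) (hΛ : ∃ b, IsZBasisOf b Λ) :
    ∃ v, IsReducedBasis F Λ v := by
  obtain ⟨b, hb⟩ := hΛ
  have mem {v : Fin l → Fin l → ℝ} (hv : IsZBasisOf v Λ) (i : Fin l) : v i ∈ Λ := by
    rw [(isZBasisOf_iff.1 hv).2]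
    exact subset_span ⟨i, rfl⟩
  have wf : WellFounded (Pi.Lex (· < ·) fun {_ : Fin l} (x y : Λ) => F x < F y) :=
    Pi.Lex.wellFounded _ fun _ => wellFounded_norm_lt hF hb
  obtain ⟨v, hv, hmin⟩ := wf.has_min {v : Fin l → Λ | IsZBasisOf (fun i => (v i : Fin l → ℝ)) Λ}
    ⟨fun i => ⟨b i, mem hb i⟩, hb⟩
  refine ⟨fun i => v i, hv, fun k x hx => ?_⟩
  by_contra! hlt
  obtain ⟨w, hw, hwlt, hwk⟩ := hv.exists_of_mem_Rset hx
  exact hmin (fun i => ⟨w i, mem hw i⟩) hw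
    ⟨k, fun i hi => Subtype.ext (hwlt i hi), by simpa only [hwk] using hlt⟩
end

section
/- Let F be a norm on ℝ^ℓ, Λ ⊂ ℝ^ℓ a full-rank lattice, and v_1, …, v_ℓ a reduced basis of Λ with respect to F with λ_i = F(v_i), so that λ_1 ≤ λ_2 ≤ ⋯ ≤ λ_ℓ. If u_1, …, u_ℓ ∈ Λ is any linearly independent set ordered so that ν_1 ≤ ν_2 ≤ ⋯ ≤ ν_ℓ where ν_j = F(u_j), then for each k = 1, …, ℓ one has λ_k ≤ (3/2)^{k-1} ν_k. -/
/-- A norm satisfies the triangle inequality for finite sums. -/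
lemma IsNorm.sum_le {l : ℕ} {F : (Fin l → ℝ) → ℝ} (hF : IsNorm F) {ι : Type*} (s : Finset ι)
    (f : ι → Fin l → ℝ) : F (∑ i ∈ s, f i) ≤ ∑ i ∈ s, F (f i) :=
  Finset.le_sum_of_subadditive F ((hF.2.1 0).2 rfl).le hF.2.2.2 s f

/-- Among `k + 1` linearly independent lattice vectors, one has a nonzero coordinate at an index
at least `k` with respect to a given basis of the lattice. -/
lemma exists_coeff_ne_zero {l : ℕ} {v u : Fin l → Fin l → ℝ} (hli : LinearIndependent ℝ u)
    (a : Fin l → Fin l → ℤ) (ha : ∀ j, u j = ∑ i, (a j i : ℝ) • v i) (k : Fin l) :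
    ∃ j ≤ k, ∃ i, k ≤ i ∧ a j i ≠ 0 := by
  classical
  by_contra! h
  have hspan : Set.range (fun j : Finset.Iic k => u j) ⊆
      Submodule.span ℝ ((Finset.Iio k).image v : Set (Fin l → ℝ)) := by
    rintro _ ⟨⟨j, hj⟩, rfl⟩
    simp only [SetLike.mem_coe]
    rw [ha j]
    refine Submodule.sum_mem _ fun i _ => ?_
    by_cases hi : k ≤ i
    · simp [h j (Finset.mem_Iic.1 hj) i hi]
    · exact Submodule.smul_mem _ _ (Submodule.subset_span
        (Finset.mem_coe.2 (Finset.mem_image_of_mem _ (Finset.mem_Iio.2 (not_le.1 hi)))))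
  have hli' : LinearIndependent ℝ (fun j : Finset.Iic k => u j) :=
    hli.comp _ Subtype.val_injective
  have hcard := (finrank_span_eq_card hli').symm.trans_le
    ((Submodule.finrank_mono (Submodule.span_le.2 hspan)).trans
      ((finrank_span_finset_le_card _).trans Finset.card_image_le))
  rw [Fintype.card_coe, Fin.card_Iic, Fin.card_Iio] at hcard
  omega

/-- If the lattice vector `x` has a nonzero coordinate at an index at least `k` with respect to a
reduced basis `v`, then either `F (v k) ≤ F x` or `F (v k)` is at most half of
`F x + ∑_{i < k} F (v i)`. -/
lemma IsReducedBasis.le_or_le_half {l : ℕ} {F : (Fin l → ℝ) → ℝ} (hF : IsNorm F)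
    {Λ : Set (Fin l → ℝ)} {v : Fin l → Fin l → ℝ} (hv : IsReducedBasis F Λ v)
    (a : Fin l → ℤ) {k i₀ : Fin l} (hi₀ : k ≤ i₀) (ha : a i₀ ≠ 0) :
    F (v k) ≤ F (∑ i, (a i : ℝ) • v i) ∨
      F (v k) ≤ (F (∑ i, (a i : ℝ) • v i) + ∑ i ∈ Finset.Iio k, F (v i)) / 2 := by
  classical
  set s := Finset.univ.filter fun i => k ≤ i with hs
  set x := ∑ i, (a i : ℝ) • v i with hx
  obtain ⟨g, hg, hg1⟩ := s.extract_gcd a ⟨k, by simp [hs]⟩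
  set d := s.gcd a with hd
  have hd0 : d ≠ 0 := fun h => ha (Finset.gcd_eq_zero_iff.1 h i₀ (by simp [hs, hi₀]))
  have hdnn : 0 ≤ d := Int.nonneg_of_normalize_eq_self Finset.normalize_gcd
  obtain hd1 | hd2 : d = 1 ∨ 2 ≤ d := by omega
  · exact Or.inl (hv.2 k x ⟨a, rfl, hd1⟩)
  right
  have hdR : (2 : ℝ) ≤ d := by exact_mod_cast hd2
  have hdR0 : (d : ℝ) ≠ 0 := by positivity
  set b : Fin l → ℤ := fun i => if k ≤ i then g i else round ((a i : ℝ) / d) with hb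
  have hmem : ∑ i, (b i : ℝ) • v i ∈ Rset v k := by
    refine ⟨b, rfl, ?_⟩
    rw [← hg1]
    exact Finset.gcd_congr rfl fun i hi => by simp [hb, (Finset.mem_filter.1 hi).2]
  have hsplit : ∑ i, (b i : ℝ) • v i = (d : ℝ)⁻¹ • x +
      ∑ i ∈ Finset.Iio k, ((round ((a i : ℝ) / d) : ℝ) - (a i : ℝ) / d) • v i := by
    have hIio : Finset.Iio k = Finset.univ.filter fun i => i < k := by ext; simp
    rw [hIio, Finset.sum_filter, hx, Finset.smul_sum, ← Finset.sum_add_distrib]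
    refine Finset.sum_congr rfl fun i _ => ?_
    by_cases hi : k ≤ i
    · have hgi : (a i : ℝ) = d * g i := by exact_mod_cast hg i (by simp [hs, hi])
      simp [hb, hi, not_lt.2 hi, smul_smul, hgi, hdR0]
    · simp only [hb, hi, not_le.1 hi, if_true, if_false, smul_smul, ← add_smul]
      congr 1
      ring
  have hround : F (∑ i ∈ Finset.Iio k, ((round ((a i : ℝ) / d) : ℝ) - (a i : ℝ) / d) • v i) ≤
      (∑ i ∈ Finset.Iio k, F (v i)) / 2 := by
    refine (hF.sum_le _ _).trans ?_
    rw [Finset.sum_div]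
    refine Finset.sum_le_sum fun i _ => ?_
    rw [hF.2.2.1, abs_sub_comm]
    nlinarith [abs_sub_round ((a i : ℝ) / d), hF.1 (v i)]
  have hscale : F ((d : ℝ)⁻¹ • x) ≤ F x / 2 := by
    rw [hF.2.2.1, abs_of_nonneg (by positivity), div_eq_inv_mul]
    exact mul_le_mul_of_nonneg_right (inv_anti₀ two_pos hdR) (hF.1 x)
  have htri := hv.2 k _ hmem
  rw [hsplit] at htri
  linarith [hF.2.2.2 ((d : ℝ)⁻¹ • x)
    (∑ i ∈ Finset.Iio k, ((round ((a i : ℝ) / d) : ℝ) - (a i : ℝ) / d) • v i)]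

/-- Let `v₁, …, v_ℓ` be a reduced basis of a full-rank lattice `Λ ⊆ ℝ^ℓ` with respect to a
norm `F`, with `λ₁ ≤ ⋯ ≤ λ_ℓ` where `λ_i = F(v_i)`. If `u₁, …, u_ℓ ∈ Λ` is any linearly
independent set ordered so that `ν₁ ≤ ⋯ ≤ ν_ℓ` where `ν_j = F(u_j)`, then
`λ_k ≤ (3/2)^{k-1} ν_k` for each `k` (indices `1, …, ℓ`; here `k : Fin ℓ` is 0-based, so
the exponent is `k`). -/
theorem reduced_basis_le_independent {l : ℕ} (F : (Fin l → ℝ) → ℝ) (hF : IsNorm F)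
    (Λ : Set (Fin l → ℝ)) (v : Fin l → Fin l → ℝ)
    (hv : IsReducedBasis F Λ v)
    (hvord : ∀ i j : Fin l, i ≤ j → F (v i) ≤ F (v j))
    (u : Fin l → Fin l → ℝ) (hu : ∀ i, u i ∈ Λ)
    (hli : LinearIndependent ℝ u)
    (huord : ∀ i j : Fin l, i ≤ j → F (u i) ≤ F (u j)) :
    ∀ k : Fin l, F (v k) ≤ (3 / 2 : ℝ) ^ (k : ℕ) * F (u k) := by
  intro k
  induction k using WellFoundedLT.induction with
  | ind k ih =>
  have hcoord : ∀ j, ∃ a : Fin l → ℤ, u j = ∑ i, (a i : ℝ) • v i := fun j => by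
    simpa [hv.1.2] using hu j
  choose a ha using hcoord
  obtain ⟨j, hjk, i₀, hi₀, hne⟩ := exists_coeff_ne_zero hli a ha k
  have hjk' : F (u j) ≤ F (u k) := huord j k hjk
  have hpow : (1 : ℝ) ≤ (3 / 2) ^ (k : ℕ) := one_le_pow₀ (by norm_num)
  have hu0 := hF.1 (u k)
  obtain h | h := hv.le_or_le_half hF (a j) hi₀ hne <;> rw [← ha j] at h
  · nlinarith
  have hgeom : ∑ i ∈ Finset.Iio k, (3 / 2 : ℝ) ^ (i : ℕ) = 2 * ((3 / 2) ^ (k : ℕ) - 1) := by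
    have hmap := Finset.sum_map (Finset.Iio k) Fin.valEmbedding fun n => (3 / 2 : ℝ) ^ n
    rw [Fin.map_valEmbedding_Iio, Nat.Iio_eq_range, geom_sum_eq (by norm_num)] at hmap
    simp only [Fin.valEmbedding_apply] at hmap
    rw [← hmap]
    ring
  have hsum : ∑ i ∈ Finset.Iio k, F (v i) ≤ 2 * ((3 / 2) ^ (k : ℕ) - 1) * F (u k) := by
    rw [← hgeom, Finset.sum_mul]
    refine Finset.sum_le_sum fun i hi => ?_
    have hik := Finset.mem_Iio.1 hi
    exact (ih i hik).trans (mul_le_mul_of_nonneg_left (huord i k hik.le) (by positivity))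
  linarith
end

section
/- (First Finiteness Theorem) Let Λ ⊂ ℝ^ℓ be a full-rank lattice with determinant 1, F a norm on ℝ^ℓ, and B = {x ∈ ℝ^ℓ : F(x) < 1} its open unit ball. For any ℤ-basis v_1, …, v_ℓ of Λ that is reduced with respect to F, setting λ_k = F(v_k), one has 2^ℓ/ℓ! ≤ vol(B)·λ_1 λ_2 ⋯ λ_ℓ ≤ 2^ℓ (3/2)^{(ℓ-1)(ℓ-2)/2}, where vol denotes Lebesgue measure on ℝ^ℓ. -/
open MeasureTheory in
/-- Fibrewise contraction of a subset of an open convex set `B ⊆ V × Y` by the factor `θ`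
towards a measurable section of the projection `B → Y`. -/
theorem exists_fiberwise_contraction {V Y : Type*} [NormedAddCommGroup V] [NormedSpace ℝ V]
    [FiniteDimensional ℝ V] [MeasurableSpace V] [BorelSpace V] [NormedAddCommGroup Y]
    [NormedSpace ℝ Y] [MeasurableSpace Y] [BorelSpace Y]
    (μ : Measure V) [μ.IsAddHaarMeasure] (ν : Measure Y) [SFinite ν]
    {B : Set (V × Y)} (hBo : IsOpen B) (hBc : Convex ℝ B)
    {A : Set (V × Y)} (hA : MeasurableSet A) (hAB : A ⊆ B)
    {θ : ℝ} (hθ : 0 < θ) (hθ' : θ ≤ 1) :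
    ∃ A' ⊆ B, MeasurableSet A' ∧
      (μ.prod ν) A' = ENNReal.ofReal (θ ^ Module.finrank ℝ V) * (μ.prod ν) A ∧
      ∀ a ∈ A', ∀ b ∈ A', a.2 = b.2 → ∃ a₀ ∈ A, ∃ b₀ ∈ A, a - b = θ • (a₀ - b₀) := by
  classical
  have := FiniteDimensional.proper_real V
  let d : ℕ → V := TopologicalSpace.denseSeq V
  let p : ℕ → Y → Prop := fun n y => (d n, y) ∈ B ∨ ∀ m, (d m, y) ∉ B
  have hslice : ∀ n, IsOpen {y | (d n, y) ∈ B} := fun n => hBo.preimage (by fun_prop)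
  have hp : ∀ n, MeasurableSet {y | p n y} := fun n => by
    have h : {y | p n y} = {y | (d n, y) ∈ B} ∪ ⋂ m, {y | (d m, y) ∈ B}ᶜ := by
      ext y
      simp [p]
    rw [h]
    exact (hslice n).measurableSet.union
      (MeasurableSet.iInter fun m => (hslice m).measurableSet.compl)
  have hex : ∀ y, ∃ n, p n y := fun y => by
    by_cases h : ∃ n, (d n, y) ∈ B
    · exact h.imp fun n hn => Or.inl hn
    · exact ⟨0, Or.inr (not_exists.1 h)⟩
  let g : Y → V := fun y => d (Nat.find (hex y))
  have hg : Measurable g := Measurable.find (f := fun n _ => d n) (fun n => measurable_const) hp hex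
  have hgB : ∀ x y, (x, y) ∈ B → (g y, y) ∈ B := fun x y hxy => by
    obtain ⟨n, hn⟩ := (TopologicalSpace.denseRange_denseSeq V).exists_mem_open
      (hBo.preimage (by fun_prop : Continuous fun x => (x, y))) ⟨x, hxy⟩
    rcases Nat.find_spec (hex y) with h | h
    · exact h
    · exact absurd hn (h _)
  let S : V × Y → V × Y := fun z => (θ⁻¹ • (z.1 - (1 - θ) • g z.2), z.2)
  have hS : Measurable S := by fun_prop
  have hSz : ∀ z, z.1 = θ • (S z).1 + (1 - θ) • g z.2 := fun z => by
    simp [S, smul_smul, hθ.ne']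
  refine ⟨S ⁻¹' A, ?_, hS hA, ?_, ?_⟩
  · intro z hz
    have h1 := hAB hz
    have h2 := hgB _ _ h1
    have h3 := hBc h1 h2 hθ.le (sub_nonneg.2 hθ') (by ring)
    convert h3 using 1
    refine Prod.ext (hSz z) ?_
    simp [S, ← add_smul]
  · rw [Measure.prod_apply_symm (hS hA), Measure.prod_apply_symm hA,
      ← lintegral_const_mul' _ _ ENNReal.ofReal_ne_top]
    refine lintegral_congr fun y => ?_
    have h1 : (fun x => (x, y)) ⁻¹' (S ⁻¹' A) =
        (fun x => x + (-((1 - θ) • g y))) ⁻¹'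
          ((fun x => θ⁻¹ • x) ⁻¹' ((fun x => (x, y)) ⁻¹' A)) := by
      ext x
      simp [S, sub_eq_add_neg]
    rw [h1, measure_preimage_add_right, Measure.addHaar_preimage_smul _ (inv_ne_zero hθ.ne')]
    congr 2
    rw [inv_pow, inv_inv, abs_of_pos (pow_pos hθ _)]
  · intro a ha b hb hab
    refine ⟨_, ha, _, hb, Prod.ext ?_ ?_⟩
    · rw [Prod.fst_sub, hSz a, hSz b, hab]
      simp [smul_sub]
    · simp [S, hab]

open MeasureTheory in
/-- Contraction in the coordinates selected by `p` inside an open convex set. -/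
theorem exists_coordinate_contraction {ι : Type*} [Fintype ι] (p : ι → Prop) [DecidablePred p]
    {B : Set (ι → ℝ)} (hBo : IsOpen B) (hBc : Convex ℝ B)
    {A : Set (ι → ℝ)} (hA : MeasurableSet A) (hAB : A ⊆ B)
    {θ : ℝ} (hθ : 0 < θ) (hθ' : θ ≤ 1) :
    ∃ A' ⊆ B, MeasurableSet A' ∧
      volume A' = ENNReal.ofReal (θ ^ Fintype.card {i // p i}) * volume A ∧
      ∀ a ∈ A', ∀ b ∈ A', (∀ i, ¬ p i → a i = b i) →
        ∃ a₀ ∈ A, ∃ b₀ ∈ A, a - b = θ • (a₀ - b₀) := by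
  let e := MeasurableEquiv.piEquivPiSubtypeProd (fun _ : ι => ℝ) p
  have he : MeasurePreserving e volume volume :=
    volume_preserving_piEquivPiSubtypeProd (fun _ : ι => ℝ) p
  have hadd : ∀ x y, e.symm (x + y) = e.symm x + e.symm y := fun x y => by
    apply e.injective
    rw [e.apply_symm_apply]
    have : ∀ u w, e (u + w) = e u + e w := fun u w => rfl
    simp [this]
  have hsmul : ∀ (c : ℝ) x, e.symm (c • x) = c • e.symm x := fun c x => by
    apply e.injective
    rw [e.apply_symm_apply]
    have : ∀ u, e (c • u) = c • e u := fun u => rfl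
    simp [this]
  let L : (({i // p i} → ℝ) × ({i // ¬ p i} → ℝ)) →ₗ[ℝ] (ι → ℝ) :=
    { toFun := e.symm, map_add' := hadd, map_smul' := hsmul }
  have hL : ∀ z, L z = e.symm z := fun _ => rfl
  obtain ⟨A', h1, h2, h3, h4⟩ := exists_fiberwise_contraction volume volume
    (hBo.preimage L.continuous_of_finiteDimensional) (hBc.linear_preimage L)
    (A := e.symm ⁻¹' A) (e.symm.measurable hA) (fun z hz => hAB hz) hθ hθ'
  refine ⟨e ⁻¹' A', ?_, e.measurable h2, ?_, ?_⟩
  · intro z hz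
    have := h1 hz
    rwa [Set.mem_preimage, hL, e.symm_apply_apply] at this
  · rw [he.measure_preimage_equiv, Measure.volume_eq_prod, h3, Module.finrank_fintype_fun_eq_card,
      ← Measure.volume_eq_prod, ← he.measure_preimage_equiv]
    simp [← Set.preimage_comp]
  · intro a ha b hb hab
    obtain ⟨a₀, ha₀, b₀, hb₀, h⟩ := h4 _ ha _ hb (funext fun i => hab i i.2)
    refine ⟨_, ha₀, _, hb₀, ?_⟩
    have := congrArg L h
    rw [map_sub, map_smul, map_sub] at this
    simpa [hL] using this

open MeasureTheory in
/-- Successive contraction along the coordinate flag: differences of points of `A` lying in the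
`(k + 1)`-st step of the flag have size less than `m k / m j`. -/
theorem exists_flag_contraction {l : ℕ} {B : Set (Fin l → ℝ)} (hBo : IsOpen B) (hBc : Convex ℝ B)
    {G : (Fin l → ℝ) → ℝ} (hG : ∀ (c : ℝ) x, 0 < c → G (c • x) = c * G x)
    (hBG : ∀ a ∈ B, ∀ b ∈ B, G (a - b) < 1) {m : ℕ → ℝ} (hm : ∀ i < l, 0 < m i)
    (hmono : ∀ i, i + 1 < l → m i ≤ m (i + 1)) (j : ℕ) (hj : j < l) :
    ∃ A ⊆ B, MeasurableSet A ∧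
      volume A = ENNReal.ofReal ((∏ i ∈ Finset.range j, m i) / m j ^ j) * volume B ∧
      ∀ a ∈ A, ∀ b ∈ A, ∀ k < j, (∀ i : Fin l, k < i → a i = b i) →
        G (a - b) < m k / m j := by
  induction j with
  | zero => exact ⟨B, subset_rfl, hBo.measurableSet, by simp, by simp⟩
  | succ j ih =>
    obtain ⟨A, h1, h2, h3, h4⟩ := ih (by omega)
    have hp := hm j (by omega)
    have hp' := hm (j + 1) hj
    have hθ : 0 < m j / m (j + 1) := div_pos hp hp'
    obtain ⟨A', h1', h2', h3', h4'⟩ := exists_coordinate_contraction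
      (fun i : Fin l => (i : ℕ) ≤ j) hBo hBc h2 h1 hθ
      ((div_le_one hp').2 (hmono j hj))
    refine ⟨A', h1', h2', ?_, ?_⟩
    · have hcard : Fintype.card {i : Fin l // (i : ℕ) ≤ j} = j + 1 := by
        have := Fintype.card_congr (⟨fun i => ⟨i.1, by have := i.2; omega⟩,
          fun i => ⟨⟨i.1, by omega⟩, by have := i.2; simp; omega⟩, fun _ => rfl, fun _ => rfl⟩ :
            {i : Fin l // (i : ℕ) ≤ j} ≃ Fin (j + 1))
        simpa using this
      rw [h3', h3, hcard, ← mul_assoc, ← ENNReal.ofReal_mul (by positivity), Finset.prod_range_succ]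
      congr 2
      rw [div_pow]
      field_simp
      ring
    · intro a ha b hb k hk hab
      obtain ⟨a₀, ha₀, b₀, hb₀, h⟩ := h4' a ha b hb fun i hi => hab i (by omega)
      rw [h, hG _ _ hθ]
      rcases Nat.lt_succ_iff_lt_or_eq.1 hk with hk | rfl
      · have hlt := h4 a₀ ha₀ b₀ hb₀ k hk fun i hi => by
          have h5 := congrFun h i
          have h6 := hab i hi
          simp only [Pi.sub_apply, Pi.smul_apply, smul_eq_mul, h6, sub_self] at h5
          exact sub_eq_zero.1 ((mul_eq_zero.1 h5.symm).resolve_left hθ.ne')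
        calc _ < m j / m (j + 1) * (m k / m j) := mul_lt_mul_of_pos_left hlt hθ
          _ = _ := by field_simp
      · exact mul_lt_of_lt_one_right hθ (hBG _ (h1 ha₀) _ (h1 hb₀))

namespace IsNorm

variable {l : ℕ} {F : (Fin l → ℝ) → ℝ}

theorem map_zero (hF : IsNorm F) : F 0 = 0 := (hF.2.1 0).2 rfl

theorem map_neg (hF : IsNorm F) (x : Fin l → ℝ) : F (-x) = F x := by
  simpa using hF.2.2.1 (-1) x

theorem map_smul_of_pos (hF : IsNorm F) {c : ℝ} (hc : 0 < c) (x : Fin l → ℝ) :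
    F (c • x) = c * F x := by
  rw [hF.2.2.1, abs_of_pos hc]

theorem map_sum_le (hF : IsNorm F) {ι : Type*} (s : Finset ι) (f : ι → Fin l → ℝ) :
    F (∑ i ∈ s, f i) ≤ ∑ i ∈ s, F (f i) :=
  Finset.le_sum_of_subadditive F hF.map_zero.le hF.2.2.2 s f

theorem le_sum_single (hF : IsNorm F) (x : Fin l → ℝ) :
    F x ≤ ∑ i, |x i| * F (Pi.single i 1) := by
  conv_lhs => rw [pi_eq_sum_univ' x]
  refine (hF.map_sum_le _ _).trans_eq ?_
  refine Finset.sum_congr rfl fun i _ => ?_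
  rw [hF.2.2.1]

theorem convexOn (hF : IsNorm F) : ConvexOn ℝ Set.univ F := by
  refine ⟨convex_univ, fun x _ y _ a b ha hb _ => (hF.2.2.2 _ _).trans_eq ?_⟩
  rw [hF.2.2.1, hF.2.2.1, abs_of_nonneg ha, abs_of_nonneg hb, smul_eq_mul, smul_eq_mul]

theorem continuous (hF : IsNorm F) : Continuous F :=
  continuousOn_univ.1 (hF.convexOn.continuousOn isOpen_univ)

theorem comp_linearMap (hF : IsNorm F) {L : (Fin l → ℝ) →ₗ[ℝ] (Fin l → ℝ)}
    (hL : Function.Injective L) : IsNorm fun x => F (L x) := by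
  refine ⟨fun x => hF.1 _, fun x => ?_, fun a x => ?_, fun x y => ?_⟩
  · rw [hF.2.1, map_eq_zero_iff L hL]
  · simp only [_root_.map_smul]
    rw [hF.2.2.1]
  · simp only [map_add]
    exact hF.2.2.2 _ _

end IsNorm

open MeasureTheory in
/-- Blichfeldt's principle for the lattice `ℤ^l`. -/
theorem volume_le_one_of_sub_notMem_int_lattice {l : ℕ} {S : Set (Fin l → ℝ)}
    (hS : MeasurableSet S)
    (h : ∀ a ∈ S, ∀ b ∈ S, ∀ z : Fin l → ℤ, a - b = (fun i => (z i : ℝ)) → z = 0) :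
    volume S ≤ 1 := by
  by_contra! hlt
  have hvol : volume (ZSpan.fundamentalDomain (Pi.basisFun ℝ (Fin l))) = 1 := by
    rw [ZSpan.fundamentalDomain_pi_basisFun, Real.volume_pi_Ico]
    simp
  rw [← hvol] at hlt
  have : Countable (Submodule.span ℤ (Set.range (Pi.basisFun ℝ (Fin l)))).toAddSubgroup :=
    inferInstanceAs (Countable (Submodule.span ℤ (Set.range (Pi.basisFun ℝ (Fin l)))))
  obtain ⟨x, y, hxy, hd⟩ := exists_pair_mem_lattice_not_disjoint_vadd
    (ZSpan.isAddFundamentalDomain' (Pi.basisFun ℝ (Fin l)) volume) hS.nullMeasurableSet hlt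
  obtain ⟨_, ⟨a, ha, rfl⟩, b, hb, hab⟩ := Set.not_disjoint_iff.1 hd
  obtain ⟨z, hz⟩ : ∃ z : Fin l → ℤ, (y - x : Fin l → ℝ) = fun i => (z i : ℝ) := by
    have h1 := (Module.Basis.mem_span_iff_repr_mem ℤ (Pi.basisFun ℝ (Fin l)) _).1 (y - x).2
    choose z hz using h1
    exact ⟨z, funext fun i => by simpa using (hz i).symm⟩
  have h2 : (y : Fin l → ℝ) + b = x + a := hab
  have h3 := h a ha b hb z (by rw [← hz, sub_eq_sub_iff_add_eq_add, add_comm a, ← h2])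
  refine hxy (Subtype.ext (sub_eq_zero.1 ?_).symm)
  rw [hz, h3]
  ext i
  simp

open MeasureTheory in
/-- **Minkowski's second theorem** for the lattice `ℤ^l` and the coordinate flag, in terms of
lower bounds `m k` for the norm of lattice points outside the `k`-th step of the flag. -/
theorem IsNorm.volume_mul_prod_le {l : ℕ} (hl : 0 < l) {G : (Fin l → ℝ) → ℝ} (hG : IsNorm G)
    {m : ℕ → ℝ} (hm : ∀ i < l, 0 < m i) (hmono : ∀ i, i + 1 < l → m i ≤ m (i + 1))
    (hlow : ∀ (k : Fin l) (z : Fin l → ℤ), z k ≠ 0 → m k ≤ G fun i => z i) :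
    volume {x | G x < 1} * ENNReal.ofReal (∏ i ∈ Finset.range l, m i) ≤ ENNReal.ofReal (2 ^ l) := by
  obtain ⟨n, rfl⟩ : ∃ n, l = n + 1 := ⟨l - 1, by omega⟩
  set B := {x | G x < 1 / 2}
  have hmn := hm n (by omega)
  have hP : 0 < ∏ i ∈ Finset.range n, m i :=
    Finset.prod_pos fun i hi => hm i (by have := Finset.mem_range.1 hi; omega)
  have hBG : ∀ a ∈ B, ∀ b ∈ B, G (a - b) < 1 := fun a ha b hb => by
    have h1 := hG.2.2.2 a (-b)
    rw [hG.map_neg, ← sub_eq_add_neg] at h1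
    have ha' : G a < 1 / 2 := ha
    have hb' : G b < 1 / 2 := hb
    linarith
  obtain ⟨A, hAB, hAm, hAv, hAG⟩ := exists_flag_contraction (B := B)
    (isOpen_lt hG.continuous continuous_const)
    (by simpa [B] using hG.convexOn.convex_lt (1 / 2))
    (fun c x hc => hG.map_smul_of_pos hc x) hBG hm hmono n (by omega)
  have hS : volume ((fun x => (m n)⁻¹ • x) ⁻¹' A) ≤ 1 := by
    refine volume_le_one_of_sub_notMem_int_lattice (hAm.preimage (by fun_prop)) ?_
    intro a ha b hb z hz
    have hscale : G ((m n)⁻¹ • a - (m n)⁻¹ • b) = (m n)⁻¹ * G (fun i => z i) := by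
      rw [← smul_sub, hz, hG.map_smul_of_pos (inv_pos.2 hmn)]
    have key : ∀ j ≤ n + 1, ∀ i : Fin (n + 1), n + 1 - j ≤ i → z i = 0 := by
      intro j
      induction j with
      | zero => exact fun _ i hi => absurd i.2 (by omega)
      | succ j ih =>
        intro hj i hi
        rcases hi.lt_or_eq with hlt | heq
        · exact ih (by omega) i (by omega)
        by_contra hne
        have h1 := hlow i z hne
        have hz' : ∀ i' : Fin (n + 1), (i : ℕ) < i' → z i' = 0 := fun i' hi' =>
          ih (by omega) i' (by omega)
        have h2 : G ((m n)⁻¹ • a - (m n)⁻¹ • b) < m i / m n := by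
          by_cases hin : (i : ℕ) = n
          · rw [hin, div_self hmn.ne']
            exact hBG _ (hAB ha) _ (hAB hb)
          · refine hAG _ ha _ hb i (by omega) fun i' hi' => ?_
            have h3 := congrFun hz i'
            rw [Pi.sub_apply, hz' i' hi', Int.cast_zero, sub_eq_zero] at h3
            simp [h3]
        rw [hscale, inv_mul_eq_div, div_lt_div_iff_of_pos_right hmn] at h2
        linarith
    exact funext fun i => key (n + 1) le_rfl i (by omega)
  have hBv : volume B = ENNReal.ofReal ((1 / 2) ^ (n + 1)) * volume {x | G x < 1} := by
    have h1 : B = (fun x => (2 : ℝ) • x) ⁻¹' {x | G x < 1} := by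
      ext x
      simp only [B, Set.mem_ofPred_eq, Set.mem_preimage, hG.map_smul_of_pos two_pos]
      constructor <;> intro h <;> linarith
    rw [h1, Measure.addHaar_preimage_smul _ two_ne_zero, Module.finrank_fintype_fun_eq_card,
      Fintype.card_fin, abs_of_pos (by positivity), one_div, inv_pow]
  rw [Measure.addHaar_preimage_smul _ (inv_ne_zero hmn.ne'), Module.finrank_fintype_fun_eq_card,
      Fintype.card_fin, abs_of_pos (by positivity), hAv, hBv, ← mul_assoc, ← mul_assoc,
      ← ENNReal.ofReal_mul (by positivity), ← ENNReal.ofReal_mul (by positivity)] at hS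
  have hc : (2 : ℝ) ^ (n + 1) * ((((m n)⁻¹ ^ (n + 1))⁻¹ *
      ((∏ i ∈ Finset.range n, m i) / m n ^ n)) * (1 / 2) ^ (n + 1)) =
      ∏ i ∈ Finset.range (n + 1), m i := by
    rw [Finset.prod_range_succ, one_div, inv_pow, inv_pow, inv_inv]
    field_simp
    ring
  calc _ = ENNReal.ofReal (2 ^ (n + 1)) * (ENNReal.ofReal ((((m n)⁻¹ ^ (n + 1))⁻¹ *
      ((∏ i ∈ Finset.range n, m i) / m n ^ n)) * (1 / 2) ^ (n + 1)) * volume {x | G x < 1}) := by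
        rw [← mul_assoc, ← ENNReal.ofReal_mul (by positivity), hc, mul_comm]
    _ ≤ _ := mul_le_of_le_one_right' hS


theorem one_add_sum_pow_le (k : ℕ) :
    1 + ∑ i ∈ Finset.range k, (3 / 2 : ℝ) ^ (i - 1) ≤ 2 * (3 / 2) ^ (k - 1) := by
  induction k with
  | zero => norm_num
  | succ k ih =>
    rw [Finset.sum_range_succ, Nat.add_sub_cancel]
    rcases k with _ | k
    · norm_num
    · rw [Nat.add_sub_cancel] at ih ⊢
      rw [pow_succ]
      linarith

/-- For a norm with respect to which the standard basis of `ℤ^l` is reduced, the norm of the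
`k`-th basis vector is controlled by every lattice point outside the span of its predecessors. -/
theorem IsNorm.single_le_of_reduced {l : ℕ} {G : (Fin l → ℝ) → ℝ} (hG : IsNorm G)
    (hred : ∀ (k : Fin l) (z : Fin l → ℤ), Finset.gcd (Finset.univ.filter fun i => k ≤ i) z = 1 →
      G (Pi.single k 1) ≤ G fun i => z i)
    (z : Fin l → ℤ) (k j : Fin l) (hkj : k ≤ j) (hj : z j ≠ 0) :
    G (Pi.single k 1) ≤ (3 / 2) ^ (k - 1 : ℕ) * G fun i => z i := by
  induction k using WellFoundedLT.induction with
  | ind k ih =>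
  set T := Finset.univ.filter fun i => k ≤ i
  have hjT : j ∈ T := by simpa [T] using hkj
  have hGz : 0 ≤ G fun i => z i := hG.1 _
  obtain ⟨g, hg, hg1⟩ := T.extract_gcd z ⟨j, hjT⟩
  set d := T.gcd z
  have hd0 : d ≠ 0 := fun h => hj (Finset.gcd_eq_zero_iff.1 h j hjT)
  have hdnonneg : 0 ≤ d := by
    have : normalize d = d := Finset.normalize_gcd
    exact Int.nonneg_of_normalize_eq_self this
  rcases (show d = 1 ∨ 2 ≤ d by omega) with h1 | h2
  · exact (hred k z h1).trans (le_mul_of_one_le_left hGz (one_le_pow₀ (by norm_num)))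
  have hd2 : (2 : ℝ) ≤ d := by exact_mod_cast h2
  have hdpos : (0 : ℝ) < d := by linarith
  let w : Fin l → ℤ := fun i => if k ≤ i then g i else round ((z i : ℝ) / d)
  have hw : T.gcd w = 1 := by
    rw [← hg1]
    refine Finset.gcd_congr rfl fun i hi => ?_
    have : k ≤ i := by simpa [T] using hi
    simp [w, this]
  have hdecomp : (fun i => (w i : ℝ)) =
      (d : ℝ)⁻¹ • (fun i => (z i : ℝ)) + fun i => (w i : ℝ) - z i / d := by
    ext i
    simp only [Pi.add_apply, Pi.smul_apply, smul_eq_mul]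
    ring
  have hrest : G (fun i => (w i : ℝ) - z i / d) ≤
      ∑ i ∈ Finset.range k, 1 / 2 * ((3 / 2) ^ (i - 1) * G fun i => z i) := by
    refine (hG.le_sum_single _).trans ?_
    calc _ ≤ ∑ i : Fin l, if (i : ℕ) < k then
          1 / 2 * ((3 / 2) ^ (i - 1 : ℕ) * G fun i => z i) else 0 := by
          refine Finset.sum_le_sum fun i _ => ?_
          split_ifs with hik
          · have hlt : ¬ k ≤ i := not_le.2 hik
            simp only [w, if_neg hlt]
            rw [abs_sub_comm]
            exact mul_le_mul (abs_sub_round _) (ih i hik (le_of_lt hik |>.trans hkj))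
              (hG.1 _) (by norm_num)
          · have hle : k ≤ i := not_lt.1 hik
            have hi : z i = d * g i := hg i (by simpa [T] using hle)
            simp [w, hle, hi, hdpos.ne']
      _ = ∑ i ∈ Finset.range l, if i < k then
          1 / 2 * ((3 / 2) ^ (i - 1) * G fun i => z i) else 0 :=
          Fin.sum_univ_eq_sum_range (fun i => if i < k then
            1 / 2 * ((3 / 2) ^ (i - 1) * G fun i => z i) else 0) l
      _ = _ := by
          rw [← Finset.sum_filter]
          congr 1
          ext i
          simp only [Finset.mem_filter, Finset.mem_range]
          omega
  have hfirst : (d : ℝ)⁻¹ * G (fun i => z i) ≤ 1 / 2 * G fun i => z i := by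
    refine mul_le_mul_of_nonneg_right ?_ hGz
    rw [one_div]
    exact inv_anti₀ two_pos hd2
  calc G (Pi.single k 1) ≤ G fun i => w i := hred k w hw
    _ ≤ 1 / 2 * G (fun i => z i) +
        ∑ i ∈ Finset.range k, 1 / 2 * ((3 / 2) ^ (i - 1) * G fun i => z i) := by
      rw [hdecomp]
      refine (hG.2.2.2 _ _).trans (add_le_add ?_ hrest)
      rwa [hG.map_smul_of_pos (inv_pos.2 hdpos)]
    _ = 1 / 2 * (1 + ∑ i ∈ Finset.range k, (3 / 2 : ℝ) ^ (i - 1)) * G fun i => z i := by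
      rw [← Finset.mul_sum, ← Finset.sum_mul]
      ring
    _ ≤ _ := by
      refine mul_le_mul_of_nonneg_right ?_ hGz
      linarith [one_add_sum_pow_le k]

theorem IsNorm.single_pos {l : ℕ} {G : (Fin l → ℝ) → ℝ} (hG : IsNorm G) (k : Fin l) :
    0 < G (Pi.single k 1) :=
  (hG.1 _).lt_of_ne fun h => by
    have := congrFun ((hG.2.1 _).1 h.symm) k
    simp at this

open MeasureTheory in
/-- The unit ball of a norm contains the cross-polytope spanned by the normalised standard
basis vectors. -/
theorem IsNorm.le_volume_mul_prod {l : ℕ} {G : (Fin l → ℝ) → ℝ} (hG : IsNorm G) :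
    ENNReal.ofReal (2 ^ l / (Nat.factorial l : ℝ)) ≤
      volume {x | G x < 1} * ENNReal.ofReal (∏ k, G (Pi.single k 1)) := by
  set P := ∏ k, G (Pi.single k 1)
  have hP : 0 < P := Finset.prod_pos fun k _ => hG.single_pos k
  let D := Matrix.toLin' (Matrix.diagonal fun k : Fin l => G (Pi.single k 1))
  have hD : LinearMap.det D = P := by
    rw [LinearMap.det_toLin', Matrix.det_diagonal]
  have hsub : D ⁻¹' {x | ∑ i, |x i| ^ (1 : ℝ) < 1} ⊆ {x | G x < 1} := fun x hx => by
    have hx' : ∑ i, |D x i| ^ (1 : ℝ) < 1 := hx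
    refine (hG.le_sum_single x).trans_lt (lt_of_eq_of_lt (Finset.sum_congr rfl fun i _ => ?_) hx')
    simp [D, Matrix.mulVec_diagonal, abs_mul, abs_of_pos (hG.single_pos i), mul_comm]
  have hle := measure_mono (μ := volume) hsub
  rw [Measure.addHaar_preimage_linearMap _ (hD ▸ hP.ne'), hD, volume_sum_rpow_lt_one _ le_rfl,
    abs_of_pos (inv_pos.2 hP), ← ENNReal.ofReal_mul (inv_pos.2 hP).le] at hle
  calc _ = ENNReal.ofReal (P⁻¹ * ((2 * Real.Gamma (1 / 1 + 1)) ^ Fintype.card (Fin l) /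
        Real.Gamma (Fintype.card (Fin l) / 1 + 1))) * ENNReal.ofReal P := by
        rw [← ENNReal.ofReal_mul' hP.le]
        congr 1
        rw [Fintype.card_fin, div_one, div_one, Real.Gamma_nat_eq_factorial, one_add_one_eq_two,
          Real.Gamma_two]
        field_simp
    _ ≤ _ := mul_le_mul_left hle _

open MeasureTheory in
theorem IsNorm.volume_mul_prod_le_of_reduced {l : ℕ} (hl : 0 < l) {G : (Fin l → ℝ) → ℝ}
    (hG : IsNorm G)
    (hred : ∀ (k : Fin l) (z : Fin l → ℤ), Finset.gcd (Finset.univ.filter fun i => k ≤ i) z = 1 →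
      G (Pi.single k 1) ≤ G fun i => z i) :
    volume {x | G x < 1} * ENNReal.ofReal (∏ k, G (Pi.single k 1)) ≤
      ENNReal.ofReal (2 ^ l * (3 / 2) ^ ((l - 1) * (l - 2) / 2)) := by
  let E : ℕ → Set ℝ := fun k =>
    {r | ∃ z : Fin l → ℤ, (∃ j : Fin l, k ≤ j ∧ z j ≠ 0) ∧ r = G fun i => z i}
  let m : ℕ → ℝ := fun k => sInf (E k)
  have hbdd : ∀ k, BddBelow (E k) := fun k => ⟨0, by rintro _ ⟨z, -, rfl⟩; exact hG.1 _⟩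
  have hne : ∀ k < l, (E k).Nonempty := fun k hk =>
    ⟨_, fun _ => 1, ⟨⟨k, hk⟩, le_rfl, one_ne_zero⟩, rfl⟩
  have hle : ∀ k : Fin l, G (Pi.single k 1) ≤ (3 / 2) ^ (k - 1 : ℕ) * m k := fun k => by
    rw [← div_le_iff₀' (by positivity)]
    refine le_csInf (hne k k.2) ?_
    rintro _ ⟨z, ⟨j, hkj, hj⟩, rfl⟩
    rw [div_le_iff₀' (by positivity)]
    exact hG.single_le_of_reduced hred z k j hkj hj
  have hm : ∀ i < l, 0 < m i := fun i hi =>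
    pos_of_mul_pos_right ((hG.single_pos _).trans_le (hle ⟨i, hi⟩)) (by positivity)
  have hmono : ∀ i, i + 1 < l → m i ≤ m (i + 1) := fun i hi =>
    csInf_le_csInf (hbdd i) (hne _ hi) (by
      rintro _ ⟨z, ⟨j, hkj, hj⟩, rfl⟩
      exact ⟨z, ⟨j, by omega, hj⟩, rfl⟩)
  have hlow : ∀ (k : Fin l) (z : Fin l → ℤ), z k ≠ 0 → m k ≤ G fun i => z i := fun k z hz =>
    csInf_le (hbdd k) ⟨z, ⟨k, le_rfl, hz⟩, rfl⟩
  have hprod : ∏ k, G (Pi.single k 1) ≤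
      (∏ i ∈ Finset.range l, m i) * (3 / 2) ^ ((l - 1) * (l - 2) / 2) := by
    calc ∏ k, G (Pi.single k 1) ≤ ∏ k : Fin l, (3 / 2) ^ (k - 1 : ℕ) * m k :=
          Finset.prod_le_prod (fun k _ => hG.1 _) fun k _ => hle k
      _ = ∏ i ∈ Finset.range l, ((3 / 2) ^ (i - 1) * m i) :=
          Fin.prod_univ_eq_prod_range (fun i => (3 / 2) ^ (i - 1) * m i) l
      _ = _ := by
          rw [Finset.prod_mul_distrib, Finset.prod_pow_eq_pow_sum, mul_comm]
          congr 2
          obtain ⟨n, rfl⟩ : ∃ n, l = n + 1 := ⟨l - 1, by omega⟩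
          rw [Finset.sum_range_succ']
          simpa using Finset.sum_range_id n
  calc _ ≤ volume {x | G x < 1} * ENNReal.ofReal
        ((∏ i ∈ Finset.range l, m i) * (3 / 2) ^ ((l - 1) * (l - 2) / 2)) := by gcongr
    _ ≤ _ := by
      rw [ENNReal.ofReal_mul' (by positivity), ENNReal.ofReal_mul' (by positivity), ← mul_assoc]
      gcongr
      exact hG.volume_mul_prod_le hl hm hmono hlow

/-- Two `ℤ`-bases of the same lattice have the same determinant up to sign. -/
theorem IsZBasisOf.abs_det_eq {l : ℕ} {Λ : Set (Fin l → ℝ)} {b v : Fin l → Fin l → ℝ}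
    (hb : IsZBasisOf b Λ) (hv : IsZBasisOf v Λ) :
    |(Matrix.of fun i j => v j i).det| = |(Matrix.of fun i j => b j i).det| := by
  have key : ∀ {u w : Fin l → Fin l → ℝ}, IsZBasisOf u Λ → IsZBasisOf w Λ →
      ∃ N : Matrix (Fin l) (Fin l) ℤ, (Matrix.of fun i j => u j i).det =
        (Matrix.of fun i j => w j i).det * (N.det : ℝ) := by
    intro u w hu hw
    have hmem : ∀ j, ∃ a : Fin l → ℤ, u j = ∑ i, (a i : ℝ) • w i := fun j => by
      have : u j ∈ Λ := by
        rw [hu.2]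
        exact ⟨Pi.single j 1, by simp [Pi.single_apply, ite_smul]⟩
      rwa [hw.2] at this
    choose a ha using hmem
    refine ⟨Matrix.of fun i j => a j i, ?_⟩
    have hmul : (Matrix.of fun i j => u j i) = (Matrix.of fun i j => w j i) *
        (Matrix.of fun i j => a j i).map (Int.castRingHom ℝ) := by
      ext i j
      simp [Matrix.mul_apply, ha j, Finset.sum_apply, mul_comm]
    rw [hmul, Matrix.det_mul, ← RingHom.mapMatrix_apply, ← RingHom.map_det]
    rfl
  obtain ⟨M, hM⟩ := key hv hb
  obtain ⟨N, hN⟩ := key hb hv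
  by_cases h0 : (Matrix.of fun i j => v j i).det = 0
  · rw [h0, zero_mul] at hN
    rw [h0, hN]
  have h1 : (N.det : ℝ) * M.det = 1 := by
    refine mul_left_cancel₀ h0 ?_
    rw [← mul_assoc, ← hN, ← hM, mul_one]
  have h2 : |(M.det : ℝ)| = 1 := by
    have : IsUnit M.det := IsUnit.of_mul_eq_one_right N.det (by exact_mod_cast h1)
    exact_mod_cast Int.isUnit_iff_abs_eq.1 this
  rw [hM, abs_mul, h2, mul_one]

/-- First Finiteness Theorem: let `Λ ⊆ ℝ^ℓ` be a full-rank lattice of determinant `1`,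
`F` a norm on `ℝ^ℓ`, and `B = {x : F x < 1}` the open unit ball. For any reduced `ℤ`-basis
`v₁, …, v_ℓ` of `Λ`, setting `λ_k = F(v_k)`, one has
`2^ℓ/ℓ! ≤ vol(B)·λ₁⋯λ_ℓ ≤ 2^ℓ (3/2)^{(ℓ-1)(ℓ-2)/2}`. -/
theorem first_finiteness_theorem {l : ℕ} (hl : 0 < l)
    (F : (Fin l → ℝ) → ℝ) (hF : IsNorm F)
    (Λ : Set (Fin l → ℝ)) (b : Fin l → Fin l → ℝ) (hb : IsZBasisOf b Λ)
    (hdet : |(Matrix.of fun i j => b j i).det| = 1)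
    (v : Fin l → Fin l → ℝ) (hv : IsReducedBasis F Λ v) :
    (2 : ℝ) ^ l / (Nat.factorial l : ℝ) ≤
        (MeasureTheory.volume {x : Fin l → ℝ | F x < 1}).toReal * ∏ k, F (v k) ∧
      (MeasureTheory.volume {x : Fin l → ℝ | F x < 1}).toReal * ∏ k, F (v k) ≤
        (2 : ℝ) ^ l * (3 / 2 : ℝ) ^ ((l - 1) * (l - 2) / 2) := by
  have hdetv := (hb.abs_det_eq hv.1).trans hdet
  let L := Matrix.toLin' (Matrix.of fun i j => v j i)
  have hL : ∀ a, L a = ∑ i, a i • v i := fun a => by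
    ext j
    simp [L, Matrix.mulVec, dotProduct, mul_comm]
  have hLdet : |LinearMap.det L| = 1 := by
    rw [LinearMap.det_toLin', hdetv]
  have hLne : LinearMap.det L ≠ 0 := fun h => by simp [h] at hLdet
  have hLinj : Function.Injective L :=
    (LinearMap.equivOfDetNeZero L hLne).injective
  have hLsingle : ∀ k, L (Pi.single k 1) = v k := fun k => by
    rw [hL]
    simp [Pi.single_apply]
  have hG : IsNorm fun x => F (L x) := hF.comp_linearMap hLinj
  have hred : ∀ (k : Fin l) (z : Fin l → ℤ),
      Finset.gcd (Finset.univ.filter fun i => k ≤ i) z = 1 →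
      F (L (Pi.single k 1)) ≤ F (L fun i => z i) := fun k z hz => by
    rw [hLsingle]
    exact hv.2 k _ ⟨z, hL _, hz⟩
  have hvol : MeasureTheory.volume {x | F (L x) < 1} = MeasureTheory.volume {x | F x < 1} := by
    have := MeasureTheory.Measure.addHaar_preimage_linearMap MeasureTheory.volume hLne {x | F x < 1}
    rwa [abs_inv, hLdet, inv_one, ENNReal.ofReal_one, one_mul] at this
  have hlower := hG.le_volume_mul_prod
  have hupper := hG.volume_mul_prod_le_of_reduced hl hred
  simp only [hLsingle] at hlower hupper
  rw [hvol] at hlower hupper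
  have hprod : 0 ≤ ∏ k, F (v k) := Finset.prod_nonneg fun k _ => hF.1 _
  rw [← ENNReal.toReal_ofReal hprod, ← ENNReal.toReal_mul]
  exact ⟨(ENNReal.ofReal_le_iff_le_toReal (hupper.trans_lt ENNReal.ofReal_lt_top).ne).1 hlower,
    ENNReal.toReal_le_of_le_ofReal (by positivity) hupper⟩
end
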